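/- Let G be a homogeneous torsion-free abelian group. Then the following are equivalent: (1) G is fully transitive; (2) for every index set I with at least two elements, the direct sum ⨁_{i∈I} G is transitive; (3) for some index set I with at least two elements, the direct sum ⨁_{i∈I} G is transitive. -/

import Mathlib

/-- `n` divides `x` in the group `G`. -/
def Divides {G : Type*} [AddCommGroup G] (n : ℕ) (x : G) : Prop :=
  ∃ z : G, n • z = x

/-- `χ(x) ≤ χ(y)`: every prime-power dividing `x` divides `y`. -/
def HeightLE {G H : Type*} [AddCommGroup G] [AddCommGroup H] (x : G) (y : H) : Prop :=
  ∀ p k : ℕ, p.Prime → Divides (p ^ k) x → Divides (p ^ k) y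

/-- `χ(x) = χ(y)`. -/
def HeightEq {G H : Type*} [AddCommGroup G] [AddCommGroup H] (x : G) (y : H) : Prop :=
  HeightLE x y ∧ HeightLE y x

def FullyTransitive (G : Type*) [AddCommGroup G] : Prop :=
  ∀ x y : G, HeightLE x y → ∃ φ : G →+ G, φ x = y

def KrylovTransitive (G : Type*) [AddCommGroup G] : Prop :=
  ∀ x y : G, HeightEq x y → ∃ φ : G →+ G, φ x = y

def TransitiveGrp (G : Type*) [AddCommGroup G] : Prop :=
  ∀ x y : G, HeightEq x y → ∃ φ : G ≃+ G, φ x = y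

def WeaklyTransitive (G : Type*) [AddCommGroup G] : Prop :=
  ∀ (x y : G) (φ ψ : G →+ G), φ x = y → ψ y = x → ∃ η : G ≃+ G, η x = y

def IsTorsionFreeGrp (G : Type*) [AddCommGroup G] : Prop :=
  ∀ (n : ℤ) (x : G), n ≠ 0 → n • x = 0 → x = 0

/-- `τ(x) ≤ τ(y)`. -/
def TypeLE {G H : Type*} [AddCommGroup G] [AddCommGroup H] (x : G) (y : H) : Prop :=
  ∃ n : ℤ, n ≠ 0 ∧ HeightLE x (n • y)

/-- `τ(x) = τ(y)`. -/
def TypeEq {G H : Type*} [AddCommGroup G] [AddCommGroup H] (x : G) (y : H) : Prop :=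
  TypeLE x y ∧ TypeLE y x

def Homogeneous (G : Type*) [AddCommGroup G] : Prop :=
  ∀ x y : G, x ≠ 0 → y ≠ 0 → TypeEq x y

/-- `π(G)`: primes `p` with `pG ≠ G`. -/
def piSet (G : Type*) [AddCommGroup G] : Set ℕ :=
  {p | p.Prime ∧ ¬ ∀ x : G, ∃ z : G, p • z = x}


/-- Cancellation of a nonzero natural number. -/
theorem aux_cancel {G : Type*} [AddCommGroup G] (hTF : IsTorsionFreeGrp G) {n : ℕ} (hn : n ≠ 0)
    {a b : G} (h : n • a = n • b) : a = b := by
  have := hTF n (a - b) (by exact_mod_cast hn) (by rw [natCast_zsmul, smul_sub, h, sub_self])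
  exact sub_eq_zero.1 this

theorem aux_div_smul {G : Type*} [AddCommGroup G] {n : ℕ} {x : G} (m : ℕ) (h : Divides n x) :
    Divides n (m • x) := by
  obtain ⟨z, rfl⟩ := h
  exact ⟨m • z, smul_comm _ _ _⟩

theorem aux_div_coprime {G : Type*} [AddCommGroup G] {n m : ℕ} {x : G} (hc : Nat.Coprime n m)
    (h : Divides n (m • x)) : Divides n x := by
  obtain ⟨z, hz⟩ := h
  have hb := Nat.gcd_eq_gcd_ab n m
  rw [hc.gcd_eq_one] at hb
  refine ⟨Nat.gcdA n m • x + Nat.gcdB n m • z, ?_⟩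
  have h1 : (1 : ℤ) • x = ((n : ℤ) * Nat.gcdA n m + m * Nat.gcdB n m) • x := by
    rw [← hb]; simp
  rw [one_smul] at h1
  conv_rhs => rw [h1]
  rw [smul_add, smul_comm n (Nat.gcdB n m) z, hz, add_smul, mul_smul, mul_comm (m : ℤ), mul_smul,
    natCast_zsmul, natCast_zsmul]

theorem aux_div_mul {G : Type*} [AddCommGroup G] (hTF : IsTorsionFreeGrp G) {p j : ℕ} {x : G}
    (hp : p ≠ 0) (h : Divides (p ^ (j + 1)) (p • x)) : Divides (p ^ j) x := by
  obtain ⟨z, hz⟩ := h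
  refine ⟨z, aux_cancel hTF hp ?_⟩
  rw [← hz, pow_succ', mul_smul]

theorem aux_div_mul' {G : Type*} [AddCommGroup G] {p j : ℕ} {x : G}
    (h : Divides (p ^ j) x) : Divides (p ^ (j + 1)) (p • x) := by
  obtain ⟨z, rfl⟩ := h
  exact ⟨z, by rw [pow_succ', mul_smul]⟩

theorem aux_div_le {G : Type*} [AddCommGroup G] {p j k : ℕ} {x : G} (hjk : j ≤ k)
    (h : Divides (p ^ k) x) : Divides (p ^ j) x := by
  obtain ⟨z, rfl⟩ := h
  refine ⟨p ^ (k - j) • z, ?_⟩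
  rw [← mul_smul, ← pow_add, Nat.add_sub_cancel' hjk]

/-- Greatest lower bounds of heights, realised by dividing `u`. -/
theorem aux_glb {G : Type*} [AddCommGroup G] (hTF : IsTorsionFreeGrp G) (v : G) (n : ℕ) :
    n ≠ 0 → ∀ u : G, HeightLE u (n • v) → ∃ (m : ℕ) (g : G), u = m • g ∧ HeightLE g v ∧
      ∀ w : G, HeightLE w u → HeightLE w v → HeightLE w g := by
  induction n using induction_on_primes with
  | zero => intro h; exact absurd rfl h
  | one =>
    intro _ u hu
    exact ⟨1, u, by simp, by simpa using hu, fun w h _ => h⟩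
  | prime_mul p a hp ih =>
    intro hn u hu
    have ha : a ≠ 0 := by rintro rfl; simp at hn
    by_cases hcase : HeightLE u (a • v)
    · exact ih ha u hcase
    have key : ∃ k, Divides (p ^ k) u ∧ ¬ Divides (p ^ k) (a • v) := by
      unfold HeightLE at hcase
      push Not at hcase
      obtain ⟨q, k, hq, h1, h2⟩ := hcase
      by_cases hqp : q = p
      · subst hqp; exact ⟨k, h1, h2⟩
      · exfalso
        apply h2
        have := hu q k hq h1
        rw [mul_smul] at this
        exact aux_div_coprime (((Nat.coprime_primes hq hp).2 hqp).pow_left k) this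
    obtain ⟨k, hk1, hk2⟩ := key
    obtain ⟨k, rfl⟩ : ∃ k', k = k' + 1 := by
      cases k with
      | zero => exact absurd ⟨a • v, by simp⟩ hk2
      | succ k => exact ⟨k, rfl⟩
    obtain ⟨z, hz⟩ := hk1
    obtain ⟨u', hu', hpu'⟩ : ∃ u', u = p • u' ∧ Divides (p ^ k) u' :=
      ⟨p ^ k • z, by rw [← hz, pow_succ', mul_smul], z, rfl⟩
    subst hu'
    have hle : HeightLE u' (a • v) := by
      intro q j hq hd
      by_cases hqp : q = p
      · subst hqp
        have := hu q (j + 1) hq (aux_div_mul' hd)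
        rw [mul_smul] at this
        exact aux_div_mul hTF hq.ne_zero this
      · have := hu q j hq (aux_div_smul p hd)
        rw [mul_smul] at this
        exact aux_div_coprime (((Nat.coprime_primes hq hp).2 hqp).pow_left j) this
    obtain ⟨m, g, hm, hg, hglb⟩ := ih ha u' hle
    refine ⟨p * m, g, by rw [mul_smul, ← hm], hg, fun w hw1 hw2 => hglb w ?_ hw2⟩
    intro q j hq hd
    by_cases hqp : q = p
    · subst hqp
      have h3 : Divides (q ^ j) (a • v) := aux_div_smul a (hw2 q j hq hd)
      have : j ≤ k := by
        by_contra hcon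
        exact hk2 (aux_div_le (by omega) h3)
      exact aux_div_le this hpu'
    · exact aux_div_coprime (((Nat.coprime_primes hq hp).2 hqp).pow_left j) (hw1 q j hq hd)

theorem aux_glb' {G : Type*} [AddCommGroup G] (hTF : IsTorsionFreeGrp G) (hhom : Homogeneous G)
    (u v : G) (hu : u ≠ 0) (hv : v ≠ 0) : ∃ (m : ℕ) (g : G), u = m • g ∧ HeightLE g v ∧
      ∀ w : G, HeightLE w u → HeightLE w v → HeightLE w g := by
  obtain ⟨n, hn, h⟩ := (hhom u v hu hv).1
  refine aux_glb hTF v n.natAbs (by simpa using hn) u ?_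
  intro p k hp hd
  obtain ⟨z, hz⟩ := h p k hp hd
  rcases Int.natAbs_eq n with h1 | h1
  · exact ⟨z, by rw [hz, ← natCast_zsmul, ← h1]⟩
  · refine ⟨-z, ?_⟩
    rw [smul_neg, hz, ← natCast_zsmul, ← neg_smul]
    congr 1
    omega

/-- Two elements are in the same orbit of the automorphism group. -/
def AuxRel {G : Type*} [AddCommGroup G] (x y : G) : Prop := ∃ φ : G ≃+ G, φ x = y

theorem AuxRel.refl {G : Type*} [AddCommGroup G] (x : G) : AuxRel x x := ⟨AddEquiv.refl G, rfl⟩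

theorem AuxRel.symm {G : Type*} [AddCommGroup G] {x y : G} (h : AuxRel x y) : AuxRel y x := by
  obtain ⟨φ, rfl⟩ := h
  exact ⟨φ.symm, by simp⟩

theorem AuxRel.trans {G : Type*} [AddCommGroup G] {x y z : G} (h : AuxRel x y) (h' : AuxRel y z) :
    AuxRel x z := by
  obtain ⟨φ, rfl⟩ := h
  obtain ⟨ψ, rfl⟩ := h'
  exact ⟨φ.trans ψ, by simp⟩

theorem AuxRel.heightLE {G : Type*} [AddCommGroup G] {x y : G} (h : AuxRel x y) :
    HeightLE x y := by
  obtain ⟨φ, rfl⟩ := h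
  rintro p k hp ⟨z, rfl⟩
  exact ⟨φ z, by simp⟩

/-- Elementary automorphisms. -/
theorem aux_elem {G : Type*} [AddCommGroup G] {I : Type*} {i j : I} (hij : i ≠ j) (α : G →+ G)
    (x : I →₀ G) : AuxRel x (x + Finsupp.single i (α (x j))) := by
  refine ⟨{ toFun := fun x => x + Finsupp.single i (α (x j))
            invFun := fun x => x - Finsupp.single i (α (x j))
            left_inv := ?_, right_inv := ?_, map_add' := ?_ }, rfl⟩
  · intro x
    simp [Finsupp.single_eq_of_ne hij.symm]
  · intro x
    simp [Finsupp.single_eq_of_ne hij.symm]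
  · intro x y
    simp only [Finsupp.add_apply, map_add, Finsupp.single_add]
    abel

theorem aux_euclid {G : Type*} [AddCommGroup G] {I : Type*} {i j : I} (hij : i ≠ j)
    (φ ψ : G →+ G) (g h : G) (hφ : φ g = h) (hψ : ψ h = g) (N : ℕ) :
    ∀ (m n : ℕ), m + n ≤ N → ∀ x : I →₀ G, x i = m • g → x j = n • h →
      ∃ y, AuxRel x y ∧ y j = 0 ∧ ∀ k, k ≠ i → k ≠ j → y k = x k := by
  induction N with
  | zero =>
    intro m n hmn x hi hj
    obtain rfl : n = 0 := by omega
    exact ⟨x, AuxRel.refl x, by simpa using hj, fun _ _ _ => rfl⟩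
  | succ N ih =>
    intro m n hmn x hi hj
    by_cases hn : n = 0
    · subst hn
      exact ⟨x, AuxRel.refl x, by simpa using hj, fun _ _ _ => rfl⟩
    by_cases hm : m = 0
    · subst hm
      refine ⟨_, (aux_elem hij ψ x).trans (aux_elem hij.symm (-φ) _), ?_, ?_⟩
      · simp [Finsupp.single_eq_of_ne hij.symm, hi, hj, hφ, hψ]
      · intro k h1 h2
        simp [Finsupp.single_eq_of_ne h1, Finsupp.single_eq_of_ne h2]
    by_cases hle : m ≤ n
    · have hrel := aux_elem hij.symm (-φ) x
      obtain ⟨y, hy1, hy2, hy3⟩ := ih m (n - m) (by omega) _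
        (show (x + Finsupp.single j ((-φ) (x i))) i = m • g by
          simp [Finsupp.single_eq_of_ne hij, hi])
        (by
          obtain ⟨d, rfl⟩ := Nat.exists_eq_add_of_le hle
          simp [hi, hj, hφ, add_smul])
      refine ⟨y, hrel.trans hy1, hy2, fun k h1 h2 => ?_⟩
      rw [hy3 k h1 h2]
      simp [Finsupp.single_eq_of_ne h2]
    · have hrel := aux_elem hij (-ψ) x
      obtain ⟨y, hy1, hy2, hy3⟩ := ih (m - n) n (by omega) (x + Finsupp.single i ((-ψ) (x j)))
        (by
          obtain ⟨d, rfl⟩ := Nat.exists_eq_add_of_le (le_of_not_ge hle)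
          simp [hi, hj, hψ, add_smul])
        (by simp [Finsupp.single_eq_of_ne hij.symm, hj])
      refine ⟨y, hrel.trans hy1, hy2, fun k h1 h2 => ?_⟩
      rw [hy3 k h1 h2]
      simp [Finsupp.single_eq_of_ne h1]

theorem aux_reduce {G : Type*} [AddCommGroup G] (hTF : IsTorsionFreeGrp G) (hhom : Homogeneous G)
    (hFT : FullyTransitive G) {I : Type*} [Nonempty I] (N : ℕ) :
    ∀ x : I →₀ G, x.support.card ≤ N → ∃ i g, AuxRel x (Finsupp.single i g) := by
  induction N with
  | zero =>
    intro x hx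
    have : x = 0 := by simpa using hx
    subst this
    exact ⟨Classical.arbitrary I, 0, by simpa using AuxRel.refl _⟩
  | succ N ih =>
    intro x hx
    by_cases h1 : x.support.card ≤ 1
    · obtain ⟨i, g, rfl⟩ := Finsupp.card_support_le_one'.1 h1
      exact ⟨i, g, AuxRel.refl _⟩
    obtain ⟨i, hi, j, hj, hij⟩ := Finset.one_lt_card.1 (not_le.1 h1)
    rw [Finsupp.mem_support_iff] at hi
    obtain ⟨m, g, hm, hg, -⟩ := aux_glb' hTF hhom (x i) (x j) hi (Finsupp.mem_support_iff.1 hj)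
    have hg0 : g ≠ 0 := by rintro rfl; simp at hm; exact hi hm
    obtain ⟨n, h, hn, hhg, hglb⟩ := aux_glb' hTF hhom (x j) g (Finsupp.mem_support_iff.1 hj) hg0
    have hgh : HeightLE g h := hglb g hg (fun _ _ _ h => h)
    obtain ⟨φ, hφ⟩ := hFT g h hgh
    obtain ⟨ψ, hψ⟩ := hFT h g hhg
    obtain ⟨y, hy1, hy2, hy3⟩ := aux_euclid hij φ ψ g h hφ hψ _ m n le_rfl x hm hn
    have hsub : y.support ⊂ x.support := by
      refine (Finset.ssubset_iff_of_subset ?_).2 ⟨j, hj, by simpa using hy2⟩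
      intro k hk
      rw [Finsupp.mem_support_iff] at hk ⊢
      by_cases hki : k = i
      · subst hki; exact hi
      by_cases hkj : k = j
      · subst hkj; exact absurd hy2 hk
      rwa [hy3 k hki hkj] at hk
    obtain ⟨i', g', h'⟩ := ih y (by have := Finset.card_lt_card hsub; omega)
    exact ⟨i', g', hy1.trans h'⟩

theorem aux_single {G : Type*} [AddCommGroup G] {I : Type*} {i j : I} (hij : i ≠ j)
    (φ ψ : G →+ G) (g h : G) (hφ : φ g = h) (hψ : ψ h = g) :
    AuxRel (Finsupp.single i g) (Finsupp.single j h) := by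
  have h1 := aux_elem hij.symm φ (Finsupp.single i g)
  have h2 := aux_elem hij ψ (Finsupp.single j h)
  simp only [Finsupp.single_eq_same, hφ, hψ] at h1 h2
  rw [add_comm] at h2
  exact h1.trans h2.symm

theorem aux_div_single {G : Type*} [AddCommGroup G] {I : Type*} (i : I) (n : ℕ) (g : G) :
    Divides n (Finsupp.single i g) ↔ Divides n g := by
  constructor
  · rintro ⟨z, hz⟩
    exact ⟨z i, by rw [← Finsupp.smul_apply, hz]; simp⟩
  · rintro ⟨z, rfl⟩
    exact ⟨Finsupp.single i z, by simp⟩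

theorem aux_forward {G : Type*} [AddCommGroup G] (hTF : IsTorsionFreeGrp G) (hhom : Homogeneous G)
    (hFT : FullyTransitive G) (I : Type*) [Nontrivial I] : TransitiveGrp (I →₀ G) := by
  intro x y hxy
  change AuxRel x y
  obtain ⟨i, g, hx⟩ := aux_reduce hTF hhom hFT _ x le_rfl
  obtain ⟨j, h, hy⟩ := aux_reduce hTF hhom hFT _ y le_rfl
  have hgh : HeightLE g h := fun p k hp hd => (aux_div_single j _ _).1
    (hy.heightLE p k hp (hxy.1 p k hp (hx.symm.heightLE p k hp ((aux_div_single i _ _).2 hd))))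
  have hhg : HeightLE h g := fun p k hp hd => (aux_div_single i _ _).1
    (hx.heightLE p k hp (hxy.2 p k hp (hy.symm.heightLE p k hp ((aux_div_single j _ _).2 hd))))
  obtain ⟨φ, hφ⟩ := hFT g h hgh
  obtain ⟨ψ, hψ⟩ := hFT h g hhg
  refine hx.trans (AuxRel.trans ?_ hy.symm)
  by_cases hij : i = j
  · subst hij
    obtain ⟨k, hk⟩ := exists_ne i
    exact (aux_single hk.symm (AddMonoidHom.id G) (AddMonoidHom.id G) g g rfl rfl).trans
      (aux_single hk φ ψ g h hφ hψ)
  · exact aux_single hij φ ψ g h hφ hψ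

theorem aux_backward {G : Type*} [AddCommGroup G] (I : Type*) [Nontrivial I]
    (hT : TransitiveGrp (I →₀ G)) : FullyTransitive G := by
  intro x y hxy
  obtain ⟨i, j, hij⟩ := exists_pair_ne I
  obtain ⟨φ, hφ⟩ := hT (Finsupp.single i x) (Finsupp.single i x + Finsupp.single j y) (by
    constructor
    · intro p k hp hd
      have h1 := (aux_div_single i _ _).1 hd
      obtain ⟨a, ha⟩ := hd
      obtain ⟨b, hb⟩ := (aux_div_single j _ _).2 (hxy p k hp h1)
      exact ⟨a + b, by rw [smul_add, ha, hb]⟩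
    · rintro p k hp ⟨z, hz⟩
      refine (aux_div_single i _ _).2 ⟨z i, ?_⟩
      rw [← Finsupp.smul_apply, hz]
      simp [Finsupp.single_eq_of_ne hij])
  refine ⟨(Finsupp.applyAddHom j).comp
    (φ.toAddMonoidHom.comp (Finsupp.singleAddHom i)), ?_⟩
  simp [hφ, Finsupp.single_eq_of_ne hij.symm]

theorem stmt_6 (G : Type*) [AddCommGroup G] (hTF : IsTorsionFreeGrp G)
    (hhom : Homogeneous G) :
    (FullyTransitive G ↔ ∀ (I : Type) (_ : Nontrivial I), TransitiveGrp (I →₀ G)) ∧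
    (FullyTransitive G ↔ ∃ (I : Type) (_ : Nontrivial I), TransitiveGrp (I →₀ G)) := by
  refine ⟨⟨fun h I _ => aux_forward hTF hhom h I, fun h => aux_backward Bool (h Bool inferInstance)⟩,
    ⟨fun h => ⟨Bool, inferInstance, aux_forward hTF hhom h Bool⟩, ?_⟩⟩
  rintro ⟨I, _, h⟩
  exact aux_backward I h
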